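/- arXiv:2504.08079 — 4 statements merged into one kernel-verified Lean document; each statement's English description precedes it below -/
import Mathlib

section
/- Let L_f, L_h, μ_f, γ be positive reals with μ_f < 2L_f and γ ≤ 1/(2L_h). Set η_{0,u} := 1/(γμ_f), η_{0,l} := 2L_f/μ_f, η_k := η_{0,u}/(η_{0,l}+k) for integers k ≥ 0, and θ_k := 1/∏_{t=0}^{k}(1 − η_t γ μ_f). Then: (a) γ ≤ 1/(L_h + η_0 L_f); (b) θ_k = (η_{0,l}+k)/(η_{0,l}−1) for all k ≥ 0; (c) Σ_{k=0}^{K−1} θ_k η_k = K/(γ(2L_f − μ_f)) for all K ≥ 1; (d) Σ_{k=0}^{K−1} θ_k η_k² ≤ (η_{0,u}²/(η_{0,l}−1))·(η_{0,l} + ln((K+η_{0,l}−1)/η_{0,l})) for all K ≥ 1; (e) limsup_{K→∞} (Σ_{j=0}^{K−1} θ_j η_j)/θ_{K−1} < ∞. -/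
open scoped RealInnerProductSpace
open Metric Filter

noncomputable section

theorem prod_one_sub_inv_add_natCast {l : ℝ} (hl : 0 < l) (k : ℕ) :
    ∏ t ∈ Finset.range (k + 1), (1 - 1 / (l + (t : ℝ))) = (l - 1) / (l + k) := by
  induction k with
  | zero => simp; field_simp
  | succ k ih =>
    have h1 : l + (k : ℝ) ≠ 0 := by positivity
    have h2 : l + ((k : ℝ) + 1) ≠ 0 := by positivity
    rw [Finset.prod_range_succ, ih]
    push_cast
    field_simp
    ring

theorem sum_inv_add_natCast_le_log {l : ℝ} (hl : 1 < l) {K : ℕ} (hK : 1 ≤ K) :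
    ∑ k ∈ Finset.range K, 1 / (l + (k : ℝ)) ≤ l + Real.log (((K : ℝ) + l - 1) / l) := by
  have hl0 : 0 < l := by linarith
  induction K, hK using Nat.le_induction with
  | base =>
    have h : 1 / l ≤ 1 := by rw [div_le_one hl0]; exact hl.le
    simp [hl0.ne'] at h ⊢
    linarith
  | succ K hK ih =>
    have hK0 : (0 : ℝ) ≤ K := K.cast_nonneg
    have h1 : 0 < (K : ℝ) + l - 1 := by linarith
    have h2 : 0 < (K : ℝ) + l := by linarith
    have hlog := Real.one_sub_inv_le_log_of_pos (div_pos h2 h1)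
    rw [Real.log_div h2.ne' h1.ne', inv_div] at hlog
    have hsub : 1 - ((K : ℝ) + l - 1) / (K + l) = 1 / (l + K) := by
      rw [add_comm l]
      field_simp
      ring
    rw [Finset.sum_range_succ]
    rw [Real.log_div h1.ne' hl0.ne'] at ih
    have hcast : ((K + 1 : ℕ) : ℝ) + l - 1 = K + l := by push_cast; ring
    rw [hcast, Real.log_div h2.ne' hl0.ne']
    linarith

theorem stmt_1 (Lf Lh μf γ : ℝ)
    (hLf : 0 < Lf) (hLh : 0 < Lh) (hμf : 0 < μf) (hγ : 0 < γ)
    (hμ2 : μf < 2 * Lf) (hγle : γ ≤ 1 / (2 * Lh))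
    (η0u η0l : ℝ) (hη0u : η0u = 1 / (γ * μf)) (hη0l : η0l = 2 * Lf / μf)
    (η : ℕ → ℝ) (hη : ∀ k : ℕ, η k = η0u / (η0l + (k : ℝ)))
    (θ : ℕ → ℝ)
    (hθ : ∀ k : ℕ, θ k = 1 / ∏ t ∈ Finset.range (k+1), (1 - η t * γ * μf)) :
    (γ ≤ 1 / (Lh + η 0 * Lf))
    ∧ (∀ k : ℕ, θ k = (η0l + (k : ℝ)) / (η0l - 1))
    ∧ (∀ K : ℕ, 1 ≤ K →
        ∑ k ∈ Finset.range K, θ k * η k = (K : ℝ) / (γ * (2 * Lf - μf)))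
    ∧ (∀ K : ℕ, 1 ≤ K →
        ∑ k ∈ Finset.range K, θ k * η k ^ 2
          ≤ η0u ^ 2 / (η0l - 1) * (η0l + Real.log (((K : ℝ) + η0l - 1) / η0l)))
    ∧ (∃ M : ℝ, ∀ᶠ K : ℕ in Filter.atTop,
        (∑ j ∈ Finset.range K, θ j * η j) / θ (K - 1) ≤ M) := by
  have hl : 1 < η0l := by rw [hη0l, lt_div_iff₀ hμf]; linarith
  have hl0 : 0 < η0l := by linarith
  have hl1 : η0l - 1 ≠ 0 := by linarith
  have hlk (k : ℕ) : η0l + (k : ℝ) ≠ 0 := by positivity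
  have hu0 : 0 < η0u := by rw [hη0u]; positivity
  have hθ_eq (k : ℕ) : θ k = (η0l + (k : ℝ)) / (η0l - 1) := by
    have hfactor (t : ℕ) : 1 - η t * γ * μf = 1 - 1 / (η0l + (t : ℝ)) := by
      have := hlk t
      rw [hη, hη0u]
      field_simp
    simp_rw [hθ, hfactor, prod_one_sub_inv_add_natCast hl0, one_div_div]
  have hθη (k : ℕ) : θ k * η k = η0u / (η0l - 1) := by
    have := hlk k
    rw [hθ_eq, hη]
    field_simp
  have hsum (K : ℕ) : ∑ k ∈ Finset.range K, θ k * η k = K * (η0u / (η0l - 1)) := by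
    simp [hθη]
  refine ⟨?_, hθ_eq, fun K _ => ?_, fun K hK => ?_, η0u, ?_⟩
  · have hη_zero : η 0 * Lf = 1 / (2 * γ) := by
      rw [hη, hη0u, hη0l]
      simp
      field_simp
    have hLh_le : Lh ≤ 1 / (2 * γ) := by
      rw [le_div_iff₀ (by positivity)] at hγle ⊢
      linarith
    have hhalves : 1 / (2 * γ) + 1 / (2 * γ) = 1 / γ := by field_simp; norm_num
    rw [hη_zero, le_one_div hγ (by positivity)]
    linarith
  · have hsub : 2 * Lf - μf ≠ 0 := by linarith
    have hl1_eq : η0l - 1 = (2 * Lf - μf) / μf := by rw [hη0l]; field_simp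
    rw [hsum, hl1_eq, hη0u]
    field_simp
  · have hterm (k : ℕ) : θ k * η k ^ 2 = η0u ^ 2 / (η0l - 1) * (1 / (η0l + (k : ℝ))) := by
      rw [pow_two, ← mul_assoc, hθη, hη]
      ring
    simp_rw [hterm, ← Finset.mul_sum]
    exact mul_le_mul_of_nonneg_left (sum_inv_add_natCast_le_log hl hK)
      (div_nonneg (sq_nonneg _) (by linarith))
  · filter_upwards [eventually_ge_atTop 1] with K hK
    have hpos : 0 < η0l - 1 := by linarith
    have hθ_pos : 0 < θ (K - 1) := by rw [hθ_eq]; positivity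
    rw [div_le_iff₀ hθ_pos, hsum, hθ_eq, Nat.cast_sub hK, mul_div_assoc', mul_div_assoc',
      div_le_div_iff_of_pos_right hpos, mul_comm]
    gcongr
    push_cast
    linarith
end
end

section
/- Let η̄ > 0 and p > 2 be arbitrary reals, let K ≥ 2 be an integer satisfying (L_h + η̄L_f)(p+1)²/(μ_f η̄) ≤ (K/ln(K))², and set the constant regularization parameter η := ((L_h + η̄L_f)/μ_f)·((p+1)ln(K)/K)². Let (x_k) be the R-VFISTA iterates with this η. Then −‖∇̃f̄(x*)‖·dist(x_K, X*_h̄) + (μ_f/2)‖x_K − x*‖² ≤ f̄(x_K) − f̄* ≤ u_6/K^{p+1} + u_7/(K^{p−1}·ln(K)), where u_6 := f̄(x_0) − f̄* + (μ_f/2)‖x_0 − x*‖² and u_7 := μ_f·(h̄(x_0) − h̄*)/((L_h + η̄L_f)(p+1)). -/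
open scoped RealInnerProductSpace
open Metric Filter

noncomputable section

section FirstOrder

variable {E : Type*} [NormedAddCommGroup E] [InnerProductSpace ℝ E]

lemma StrongConvexOn.le_along_segment {F : E → ℝ} {m : ℝ} (hF : StrongConvexOn Set.univ m F)
    (x y : E) {t : ℝ} (ht₀ : 0 ≤ t) (ht₁ : t ≤ 1) :
    F (x + t • (y - x)) ≤ F x + t * (F y - F x) - m / 2 * t * (1 - t) * ‖y - x‖ ^ 2 := by
  have h := hF.2 (Set.mem_univ x) (Set.mem_univ y) (sub_nonneg.2 ht₁) ht₀ (sub_add_cancel 1 t)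
  rw [show x + t • (y - x) = (1 - t) • x + t • y by module]
  simp only [smul_eq_mul, norm_sub_rev x y] at h
  linarith

/-- A subgradient of a strongly convex function satisfies the quadratically improved inequality. -/
lemma StrongConvexOn.add_inner_add_sq_le {F : E → ℝ} {m : ℝ} (hF : StrongConvexOn Set.univ m F)
    {x g : E} (hg : ∀ y, F x + ⟪g, y - x⟫ ≤ F y) (y : E) :
    F x + ⟪g, y - x⟫ + m / 2 * ‖y - x‖ ^ 2 ≤ F y := by
  have key : ∀ t ∈ Set.Ioo (0 : ℝ) 1,
      F x + ⟪g, y - x⟫ + m / 2 * (1 - t) * ‖y - x‖ ^ 2 ≤ F y := fun t ht ↦ by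
    have h₁ := hF.le_along_segment x y ht.1.le ht.2.le
    have h₂ := hg (x + t • (y - x))
    rw [add_sub_cancel_left, real_inner_smul_right] at h₂
    refine le_of_mul_le_mul_left ?_ ht.1
    linarith
  have hlim : Tendsto (fun t : ℝ ↦ F x + ⟪g, y - x⟫ + m / 2 * (1 - t) * ‖y - x‖ ^ 2)
      (nhdsWithin 0 (Set.Ioi 0)) (nhds (F x + ⟪g, y - x⟫ + m / 2 * (1 - 0) * ‖y - x‖ ^ 2)) :=
    tendsto_nhdsWithin_of_tendsto_nhds (Continuous.tendsto (by fun_prop) 0)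
  simpa using le_of_tendsto hlim
    (eventually_of_mem (Ioo_mem_nhdsGT one_pos) key)

lemma hasDerivAt_along_line [CompleteSpace E] {F : E → ℝ} {g x d : E} {t : ℝ}
    (hF : HasGradientAt F g (x + t • d)) :
    HasDerivAt (fun s : ℝ ↦ F (x + s • d)) ⟪g, d⟫ t := by
  have hline : HasDerivAt (fun s : ℝ ↦ x + s • d) d t := by
    simpa using ((hasDerivAt_id t).smul_const d).const_add x
  exact (hF.hasFDerivAt.comp_hasDerivAt t hline).congr_deriv (by simp)

lemma ConvexOn.add_inner_gradient_le [CompleteSpace E] {F : E → ℝ}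
    (hF : ConvexOn ℝ Set.univ F) {x g : E} (hg : HasGradientAt F g x) (y : E) :
    F x + ⟪g, y - x⟫ ≤ F y := by
  have hd := (hasDerivAt_along_line (d := y - x) (t := 0)
    (by simpa using hg)).tendsto_slope_zero_right
  have hle : ⟪g, y - x⟫ ≤ F y - F x := by
    refine le_of_tendsto hd (eventually_of_mem (Ioo_mem_nhdsGT one_pos) fun t ht ↦ ?_)
    have h := (strongConvexOn_zero.2 hF).le_along_segment x y ht.1.le ht.2.le
    simp only [zero_add, zero_smul, add_zero, smul_eq_mul]
    rw [inv_mul_le_iff₀ ht.1]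
    linarith
  linarith

/-- The descent lemma. -/
lemma le_add_inner_add_sq_of_lipschitz_gradient [CompleteSpace E] {F : E → ℝ} {F' : E → E} {L : ℝ}
    (hF : ∀ x, HasGradientAt F (F' x) x) (hL : ∀ x y, ‖F' x - F' y‖ ≤ L * ‖x - y‖) (x y : E) :
    F y ≤ F x + ⟪F' x, y - x⟫ + L / 2 * ‖y - x‖ ^ 2 := by
  set d := y - x with hd
  have hderiv : ∀ t : ℝ, HasDerivAt
      (fun s : ℝ ↦ F (x + s • d) - s * ⟪F' x, d⟫ - L / 2 * ‖d‖ ^ 2 * s ^ 2)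
      (⟪F' (x + t • d), d⟫ - ⟪F' x, d⟫ - L * ‖d‖ ^ 2 * t) t := fun t ↦ by
    have h₁ := hasDerivAt_along_line (d := d) (t := t) (hF (x + t • d))
    have h₂ := (hasDerivAt_id t).mul_const ⟪F' x, d⟫
    have h₃ := (hasDerivAt_pow 2 t).const_mul (L / 2 * ‖d‖ ^ 2)
    refine ((h₁.sub h₂).sub h₃).congr_deriv ?_
    push_cast
    ring
  have hanti : AntitoneOn
      (fun s : ℝ ↦ F (x + s • d) - s * ⟪F' x, d⟫ - L / 2 * ‖d‖ ^ 2 * s ^ 2) (Set.Icc 0 1) := by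
    refine antitoneOn_of_deriv_nonpos (convex_Icc 0 1)
      (fun t _ ↦ (hderiv t).continuousAt.continuousWithinAt)
      (fun t _ ↦ (hderiv t).differentiableAt.differentiableWithinAt) fun t ht ↦ ?_
    rw [interior_Icc] at ht
    rw [(hderiv t).deriv, ← inner_sub_left]
    have h₁ := real_inner_le_norm (F' (x + t • d) - F' x) d
    have h₂ := hL (x + t • d) x
    rw [add_sub_cancel_left, norm_smul, Real.norm_of_nonneg ht.1.le] at h₂
    nlinarith [mul_le_mul_of_nonneg_right h₂ (norm_nonneg d)]
  have h := hanti (Set.left_mem_Icc.2 zero_le_one) (Set.right_mem_Icc.2 zero_le_one) zero_le_one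
  have hxd : x + d = y := by rw [hd]; abel
  simp only [zero_smul, one_smul, add_zero, hxd] at h
  linarith

lemma ConvexOn.strongConvexOn_add_sq_norm_sub {ω : E → ℝ} (hω : ConvexOn ℝ Set.univ ω)
    (L : ℝ) (v : E) : StrongConvexOn Set.univ L fun u ↦ ω u + L / 2 * ‖u - v‖ ^ 2 := by
  refine ⟨convex_univ, fun x hx y hy a b ha hb hab ↦ ?_⟩
  have h₁ := hω.2 hx hy ha hb hab
  have h₂ : ‖a • x + b • y - v‖ ^ 2
      = a * ‖x - v‖ ^ 2 + b * ‖y - v‖ ^ 2 - a * b * ‖x - y‖ ^ 2 := by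
    obtain rfl : a = 1 - b := by linarith
    rw [show (1 - b) • x + b • y - v = (x - v) - b • (x - y) by module,
      show y - v = (x - v) - (x - y) by abel, norm_sub_sq_real, norm_sub_sq_real (x - v) (x - y),
      norm_smul, real_inner_smul_right, Real.norm_of_nonneg hb]
    ring
  simp only [smul_eq_mul] at h₁ ⊢
  rw [h₂]
  linarith

end FirstOrder

section AcceleratedProximalGradient

variable {E : Type*} [NormedAddCommGroup E] [InnerProductSpace ℝ E] [CompleteSpace E]

/-- The fundamental inequality of the proximal gradient step for a composite objective `φ + ω`. -/
lemma proximal_gradient_inequality {φ ω : E → ℝ} {φ' : E → E} {L m : ℝ} (hL : 0 < L)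
    (hφ : ∀ x, HasGradientAt φ (φ' x) x) (hLip : ∀ x y, ‖φ' x - φ' y‖ ≤ L * ‖x - y‖)
    (hsc : StrongConvexOn Set.univ m φ) (hconv : ConvexOn ℝ Set.univ φ)
    (hω : ConvexOn ℝ Set.univ ω) {x₁ y : E}
    (hmin : ∀ u, ω x₁ + L / 2 * ‖x₁ - (y - L⁻¹ • φ' y)‖ ^ 2
      ≤ ω u + L / 2 * ‖u - (y - L⁻¹ • φ' y)‖ ^ 2) (w : E) :
    φ x₁ + ω x₁ + L / 2 * ‖w - x₁‖ ^ 2 ≤ φ w + ω w + (L - m) / 2 * ‖w - y‖ ^ 2 := by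
  have hprox := (hω.strongConvexOn_add_sq_norm_sub L (y - L⁻¹ • φ' y)).add_inner_add_sq_le
    (x := x₁) (g := 0) (by simpa using hmin) w
  have hsq : ∀ u, L / 2 * ‖u - (y - L⁻¹ • φ' y)‖ ^ 2
      = L / 2 * ‖u - y‖ ^ 2 + ⟪φ' y, u - y⟫ + L⁻¹ / 2 * ‖φ' y‖ ^ 2 := fun u ↦ by
    rw [← sub_add, norm_add_sq_real, norm_smul, real_inner_smul_right,
      Real.norm_of_nonneg (inv_nonneg.2 hL.le), real_inner_comm]
    field_simp
  have hupper := le_add_inner_add_sq_of_lipschitz_gradient hφ hLip y x₁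
  have hlower := hsc.add_inner_add_sq_le (hconv.add_inner_gradient_le (hφ y)) w
  simp only [hsq, inner_zero_left] at hprox
  linarith

/-- One step of the accelerated proximal gradient method contracts the Lyapunov function relative
to any reference point `z`. -/
lemma accelerated_step {φ ω : E → ℝ} {φ' : E → E} {m s : ℝ} (hm : 0 < m) (hs : 1 ≤ s)
    (hφ : ∀ x, HasGradientAt φ (φ' x) x) (hLip : ∀ x y, ‖φ' x - φ' y‖ ≤ m * s ^ 2 * ‖x - y‖)
    (hsc : StrongConvexOn Set.univ m φ) (hconv : ConvexOn ℝ Set.univ φ)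
    (hω : ConvexOn ℝ Set.univ ω) {x x₁ δ : E}
    (hmin : ∀ u,
      ω x₁ + m * s ^ 2 / 2 * ‖x₁ - (x + ((s - 1) / (s + 1)) • δ
          - (m * s ^ 2)⁻¹ • φ' (x + ((s - 1) / (s + 1)) • δ))‖ ^ 2
      ≤ ω u + m * s ^ 2 / 2 * ‖u - (x + ((s - 1) / (s + 1)) • δ
          - (m * s ^ 2)⁻¹ • φ' (x + ((s - 1) / (s + 1)) • δ))‖ ^ 2) (z : E) :
    φ x₁ + ω x₁ - (φ z + ω z) + m / 2 * ‖x₁ + (s - 1) • (x₁ - x) - z‖ ^ 2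
      ≤ (1 - 1 / s) * (φ x + ω x - (φ z + ω z) + m / 2 * ‖x + (s - 1) • δ - z‖ ^ 2) := by
  have hs₀ : 0 < s := by linarith
  have hθ₀ : 0 ≤ 1 / s := by positivity
  have hθ₁ : 1 / s ≤ 1 := by rw [div_le_one hs₀]; exact hs
  have hprox := proximal_gradient_inequality (by positivity) hφ hLip hsc hconv hω hmin
    (x + (1 / s) • (z - x))
  have hφw := hsc.le_along_segment x z hθ₀ hθ₁
  have hωw := (strongConvexOn_zero.2 hω).le_along_segment x z hθ₀ hθ₁
  have hnew : m / 2 * ‖x₁ + (s - 1) • (x₁ - x) - z‖ ^ 2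
      = m * s ^ 2 / 2 * ‖x + (1 / s) • (z - x) - x₁‖ ^ 2 := by
    rw [show x₁ + (s - 1) • (x₁ - x) - z = (-s) • (x + (1 / s) • (z - x) - x₁) by
      match_scalars <;> field_simp <;> ring, norm_smul, mul_pow, Real.norm_eq_abs, sq_abs]
    ring
  have hmom : x + (1 / s) • (z - x) - (x + ((s - 1) / (s + 1)) • δ)
      = (1 / s) • (z - x) - ((s - 1) / (s + 1)) • δ := by abel
  have hold : x + (s - 1) • δ - z = (s - 1) • δ - (z - x) := by abel
  have hquad : (m * s ^ 2 - m) / 2 * ‖(1 / s) • (z - x) - ((s - 1) / (s + 1)) • δ‖ ^ 2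
      - m / 2 * (1 / s) * (1 - 1 / s) * ‖z - x‖ ^ 2
      ≤ (1 - 1 / s) * (m / 2 * ‖(s - 1) • δ - (z - x)‖ ^ 2) := by
    have hgap : (1 - 1 / s) * (m / 2 * ‖(s - 1) • δ - (z - x)‖ ^ 2)
        - ((m * s ^ 2 - m) / 2 * ‖(1 / s) • (z - x) - ((s - 1) / (s + 1)) • δ‖ ^ 2
          - m / 2 * (1 / s) * (1 - 1 / s) * ‖z - x‖ ^ 2)
        = m / 2 * ((s - 1) ^ 3 / (s * (s + 1))) * ‖δ‖ ^ 2 := by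
      rw [norm_sub_sq_real ((s - 1) • δ), norm_sub_sq_real ((1 / s) • (z - x))]
      simp only [norm_smul, mul_pow, Real.norm_eq_abs, sq_abs, real_inner_smul_left,
        real_inner_smul_right, real_inner_comm (z - x) δ]
      field_simp
      ring
    have : 0 ≤ m / 2 * ((s - 1) ^ 3 / (s * (s + 1))) * ‖δ‖ ^ 2 := by
      have : 0 ≤ s - 1 := by linarith
      positivity
    linarith
  rw [hmom] at hprox
  rw [hnew, hold]
  linarith

/-- Linear rate of the accelerated proximal gradient method with condition number `s ^ 2`, relative
to any reference point `z`. -/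
lemma accelerated_rate {φ ω : E → ℝ} {φ' : E → E} {m s : ℝ} (hm : 0 < m) (hs : 1 ≤ s)
    (hφ : ∀ x, HasGradientAt φ (φ' x) x) (hLip : ∀ x y, ‖φ' x - φ' y‖ ≤ m * s ^ 2 * ‖x - y‖)
    (hsc : StrongConvexOn Set.univ m φ) (hconv : ConvexOn ℝ Set.univ φ)
    (hω : ConvexOn ℝ Set.univ ω) {x y : ℕ → E} (hy₀ : y 0 = x 0)
    (hmin : ∀ k u,
      ω (x (k + 1)) + m * s ^ 2 / 2 * ‖x (k + 1) - (y k - (m * s ^ 2)⁻¹ • φ' (y k))‖ ^ 2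
      ≤ ω u + m * s ^ 2 / 2 * ‖u - (y k - (m * s ^ 2)⁻¹ • φ' (y k))‖ ^ 2)
    (hy : ∀ k, y (k + 1) = x (k + 1) + ((s - 1) / (s + 1)) • (x (k + 1) - x k)) (z : E) (k : ℕ) :
    φ (x k) + ω (x k) - (φ z + ω z)
      ≤ (1 - 1 / s) ^ k * (φ (x 0) + ω (x 0) - (φ z + ω z) + m / 2 * ‖x 0 - z‖ ^ 2) := by
  have hq : 0 ≤ 1 - 1 / s := by
    rw [sub_nonneg, div_le_one (by linarith)]
    exact hs
  obtain ⟨δ, hδ, hle⟩ : ∃ δ, y k = x k + ((s - 1) / (s + 1)) • δ ∧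
      φ (x k) + ω (x k) - (φ z + ω z) + m / 2 * ‖x k + (s - 1) • δ - z‖ ^ 2
        ≤ (1 - 1 / s) ^ k * (φ (x 0) + ω (x 0) - (φ z + ω z) + m / 2 * ‖x 0 - z‖ ^ 2) := by
    induction k with
    | zero => exact ⟨0, by simp [hy₀], by simp⟩
    | succ k ih =>
      obtain ⟨δ, hδ, hle⟩ := ih
      refine ⟨x (k + 1) - x k, hy k, ?_⟩
      refine (accelerated_step hm hs hφ hLip hsc hconv hω (hδ ▸ hmin k) z).trans ?_
      rw [pow_succ' (1 - 1 / s), mul_assoc]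
      exact mul_le_mul_of_nonneg_left hle hq
  have : 0 ≤ m / 2 * ‖x k + (s - 1) • δ - z‖ ^ 2 := by positivity
  linarith

end AcceleratedProximalGradient

lemma one_sub_inv_pow_le_rpow_neg {s r : ℝ} {K : ℕ} (hs : 1 ≤ s) (hK : 0 < K)
    (h : s * (r * Real.log K) ≤ K) : (1 - 1 / s) ^ K ≤ ((K : ℝ) ^ r)⁻¹ := by
  have hs₀ : 0 < s := by linarith
  have hK₀ : (0 : ℝ) < K := by exact_mod_cast hK
  have hq : 0 ≤ 1 - 1 / s := by
    rw [sub_nonneg, div_le_one hs₀]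
    exact hs
  calc (1 - 1 / s) ^ K ≤ Real.exp (-(1 / s)) ^ K :=
        pow_le_pow_left₀ hq (Real.one_sub_le_exp_neg _) K
    _ = Real.exp (-(K / s)) := by rw [← Real.exp_nat_mul]; ring_nf
    _ ≤ Real.exp (-(r * Real.log K)) := by
        rw [Real.exp_le_exp, neg_le_neg_iff, le_div_iff₀ hs₀]
        linarith
    _ = ((K : ℝ) ^ r)⁻¹ := by rw [Real.rpow_def_of_pos hK₀, Real.exp_neg, mul_comm]

lemma neg_norm_mul_infDist_le_inner {E : Type*} [NormedAddCommGroup E] [InnerProductSpace ℝ E]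
    {X : Set E} (hX : X.Nonempty) {g a : E} (hg : ∀ y ∈ X, 0 ≤ ⟪g, y - a⟫) (x : E) :
    -‖g‖ * infDist x X ≤ ⟪g, x - a⟫ := by
  have := hX.to_subtype
  suffices -⟪g, x - a⟫ ≤ ‖g‖ * infDist x X by linarith
  rw [infDist_eq_iInf, Real.mul_iInf_of_nonneg (norm_nonneg g)]
  refine le_ciInf fun y ↦ ?_
  have h₁ := hg y y.2
  have h₂ := real_inner_le_norm g (y - x)
  rw [dist_eq_norm, norm_sub_rev]
  have h₃ : ⟪g, x - a⟫ = ⟪g, (y : E) - a⟫ - ⟪g, (y : E) - x⟫ := by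
    rw [← inner_sub_right, sub_sub_sub_cancel_left]
  linarith

theorem stmt_3
    {n : ℕ}
    (f h ωf ωh : EuclideanSpace ℝ (Fin n) → ℝ)
    (f' h' : EuclideanSpace ℝ (Fin n) → EuclideanSpace ℝ (Fin n))
    (Lf Lh μf : ℝ)
    (hμf_pos : 0 < μf) (hμf_le : μf ≤ Lf) (hLh_pos : 0 < Lh)
    (hf_grad : ∀ x, HasGradientAt f (f' x) x)
    (hf_lip : ∀ x y, ‖f' x - f' y‖ ≤ Lf * ‖x - y‖)
    (hf_sc : StrongConvexOn Set.univ μf f)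
    (hh_grad : ∀ x, HasGradientAt h (h' x) x)
    (hh_lip : ∀ x y, ‖h' x - h' y‖ ≤ Lh * ‖x - y‖)
    (hh_conv : ConvexOn ℝ Set.univ h)
    (hωf_conv : ConvexOn ℝ Set.univ ωf)
    (hωh_conv : ConvexOn ℝ Set.univ ωh)
    (fbar hbar : EuclideanSpace ℝ (Fin n) → ℝ)
    (hfbar : ∀ x, fbar x = f x + ωf x)
    (hhbar : ∀ x, hbar x = h x + ωh x)
    (X : Set (EuclideanSpace ℝ (Fin n)))
    (hX : X = {z | ∀ y, hbar z ≤ hbar y})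
    (hXne : X.Nonempty)
    (hstar : ℝ)
    (hhstar : IsGLB (Set.range hbar) hstar)
    (xstar : EuclideanSpace ℝ (Fin n))
    (hxstar_mem : xstar ∈ X)
    (hxstar_min : ∀ y ∈ X, fbar xstar ≤ fbar y)
    (g : EuclideanSpace ℝ (Fin n))
    (hg_sub : ∀ y, fbar xstar + ⟪g, y - xstar⟫ ≤ fbar y)
    (hg_opt : ∀ y ∈ X, (0:ℝ) ≤ ⟪g, y - xstar⟫)
    (ηbar p : ℝ) (hηbar : 0 < ηbar) (hp : 2 < p)
    (K : ℕ) (hK : 2 ≤ K)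
    (hKcond : (Lh + ηbar * Lf) * (p + 1) ^ 2 / (μf * ηbar)
        ≤ ((K : ℝ) / Real.log K) ^ 2)
    (η : ℝ)
    (hη : η = (Lh + ηbar * Lf) / μf * ((p + 1) * Real.log K / K) ^ 2)
    (x y : ℕ → EuclideanSpace ℝ (Fin n))
    (κ γ : ℝ)
    (hκ : κ = (Lh + η * Lf) / (η * μf))
    (hγ : γ = 1 / (Lh + η * Lf))
    (hy0 : y 0 = x 0)
    (hx_iter : ∀ k u,
      ωh (x (k+1)) + η * ωf (x (k+1))
        + 1 / (2*γ) * ‖x (k+1) - (y k - γ • (h' (y k) + η • f' (y k)))‖ ^ 2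
      ≤ ωh u + η * ωf u
        + 1 / (2*γ) * ‖u - (y k - γ • (h' (y k) + η • f' (y k)))‖ ^ 2)
    (hy_iter : ∀ k, y (k+1) = x (k+1)
        + ((Real.sqrt κ - 1) / (Real.sqrt κ + 1)) • (x (k+1) - x k))
    :
    (-‖g‖ * Metric.infDist (x K) X + μf / 2 * ‖x K - xstar‖ ^ 2
        ≤ fbar (x K) - fbar xstar)
    ∧ fbar (x K) - fbar xstar
        ≤ (fbar (x 0) - fbar xstar + μf / 2 * ‖x 0 - xstar‖ ^ 2) / (K : ℝ) ^ (p + 1)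
          + μf * (hbar (x 0) - hstar) / ((Lh + ηbar * Lf) * (p + 1))
            / ((K : ℝ) ^ (p - 1) * Real.log K) := by
  have hLf_pos : 0 < Lf := hμf_pos.trans_le hμf_le
  have hM : 0 < Lh + ηbar * Lf := by positivity
  have hK_pos : (0 : ℝ) < K := by positivity
  have hK_two : (2 : ℝ) ≤ K := by exact_mod_cast hK
  have hlog : 2⁻¹ < Real.log K := by
    have := Real.log_two_gt_d9
    have := Real.log_le_log two_pos hK_two
    linarith
  have hlog_pos : 0 < Real.log K := by linarith
  have hp_pos : 0 < p + 1 := by linarith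
  have hη_pos : 0 < η := by rw [hη]; positivity
  have hη_le : η ≤ ηbar := by
    rw [div_le_iff₀ (by positivity), div_pow, div_mul_eq_mul_div, le_div_iff₀ (by positivity)]
      at hKcond
    rw [hη, div_pow, mul_pow, div_mul_div_comm, div_le_iff₀ (by positivity)]
    linarith
  set s := Real.sqrt κ with hs
  have hκ_one : 1 ≤ κ := by
    rw [hκ, one_le_div (by positivity)]
    nlinarith
  have hs_one : 1 ≤ s := Real.one_le_sqrt.2 hκ_one
  have hs_sq : η * μf * s ^ 2 = Lh + η * Lf := by
    rw [hs, Real.sq_sqrt (by linarith), hκ]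
    field_simp
  have hs_le : s * ((p + 1) * Real.log K) ≤ K := by
    have hsq : (s * ((p + 1) * Real.log K)) ^ 2 ≤ (K : ℝ) ^ 2 := by
      have hηK : η * μf * K ^ 2 = (Lh + ηbar * Lf) * ((p + 1) * Real.log K) ^ 2 := by
        rw [hη]
        field_simp
      have hM_le : Lh + η * Lf ≤ Lh + ηbar * Lf := by gcongr
      refine le_of_mul_le_mul_left ?_ (mul_pos hη_pos hμf_pos)
      rw [hηK, mul_pow, ← mul_assoc, hs_sq]
      gcongr
    exact le_of_sq_le_sq hsq hK_pos.le
  have hfbar_sc : StrongConvexOn Set.univ μf fbar := by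
    have := UniformConvexOn.add hf_sc hωf_conv.uniformConvexOn_zero
    rw [add_zero] at this
    rwa [show fbar = f + ωf from funext hfbar]
  have hφ_grad : ∀ z, HasGradientAt (fun z ↦ h z + η * f z) (h' z + η • f' z) z := fun z ↦ by
    have := (hh_grad z).hasFDerivAt.add ((hf_grad z).hasFDerivAt.const_mul η)
    exact this.congr_fderiv (by simp)
  have hφ_lip : ∀ a b, ‖(h' a + η • f' a) - (h' b + η • f' b)‖
      ≤ η * μf * s ^ 2 * ‖a - b‖ := fun a b ↦ by
    rw [hs_sq, show (h' a + η • f' a) - (h' b + η • f' b)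
      = (h' a - h' b) + η • (f' a - f' b) by module]
    refine (norm_add_le _ _).trans ?_
    rw [norm_smul, Real.norm_of_nonneg hη_pos.le]
    nlinarith [hh_lip a b, mul_le_mul_of_nonneg_left (hf_lip a b) hη_pos.le]
  have hφ_sc : StrongConvexOn Set.univ (η * μf) fun z ↦ h z + η * f z := by
    refine ⟨convex_univ, fun a ha b hb t r ht hr htr ↦ ?_⟩
    have h₁ := hh_conv.2 ha hb ht hr htr
    have h₂ := mul_le_mul_of_nonneg_left (hf_sc.2 ha hb ht hr htr) hη_pos.le
    simp only [smul_eq_mul] at h₁ h₂ ⊢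
    linarith
  have hφ_conv : ConvexOn ℝ Set.univ fun z ↦ h z + η * f z :=
    (hφ_sc.strictConvexOn (by positivity)).convexOn
  have hω_conv : ConvexOn ℝ Set.univ fun z ↦ ωh z + η * ωf z :=
    hωh_conv.add (hωf_conv.smul hη_pos.le)
  have hrate := fun z ↦ accelerated_rate (mul_pos hη_pos hμf_pos) hs_one hφ_grad hφ_lip hφ_sc
    hφ_conv hω_conv hy0 (fun k u ↦ by
      have hstep := hx_iter k u
      have hγ' : γ = (η * μf * s ^ 2)⁻¹ := by rw [hγ, hs_sq, one_div]
      have hγ_half : 1 / (2 * (η * μf * s ^ 2)⁻¹) = η * μf * s ^ 2 / 2 := by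
        rw [one_div, mul_inv, inv_inv]
        ring
      rwa [hγ', hγ_half] at hstep) hy_iter z K
  have hstar_eq : hbar xstar = hstar := by
    refine le_antisymm (hhstar.2 ?_) (hhstar.1 ⟨xstar, rfl⟩)
    rintro _ ⟨z, rfl⟩
    rw [hX] at hxstar_mem
    exact hxstar_mem z
  refine ⟨?_, ?_⟩
  · have h₁ := hfbar_sc.add_inner_add_sq_le hg_sub (x K)
    have h₂ := neg_norm_mul_infDist_le_inner hXne hg_opt (x K)
    linarith
  set c := ((K : ℝ) ^ (p + 1))⁻¹ with hc
  have hc_pos : 0 < c := by positivity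
  have hc_le : c ≤ 1 := inv_le_one_of_one_le₀ (Real.one_le_rpow (by linarith) hp_pos.le)
  have hqc : (1 - 1 / s) ^ K ≤ c :=
    one_sub_inv_pow_le_rpow_neg hs_one (by omega) hs_le
  set D₀ := hbar (x 0) - hstar with hD₀
  have hD₀_nonneg : 0 ≤ D₀ := sub_nonneg.2 (hhstar.1 ⟨x 0, rfl⟩)
  have hDK_nonneg : hstar ≤ hbar (x K) := hhstar.1 ⟨x K, rfl⟩
  set u := fbar (x 0) - fbar xstar + μf / 2 * ‖x 0 - xstar‖ ^ 2 with hu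
  have hbound : η * (fbar (x K) - fbar xstar) ≤ c * (D₀ + η * u) := by
    have h₁ := hrate xstar
    have h₂ := hrate (x 0)
    rw [sub_self, sub_self, norm_zero, zero_pow two_ne_zero, mul_zero, add_zero, mul_zero] at h₂
    have hE₀ : h (x 0) + η * f (x 0) + (ωh (x 0) + η * ωf (x 0))
        - (h xstar + η * f xstar + (ωh xstar + η * ωf xstar))
        + η * μf / 2 * ‖x 0 - xstar‖ ^ 2 = D₀ + η * u := by
      rw [hD₀, hu, ← hstar_eq, hhbar, hhbar, hfbar, hfbar]
      ring
    have hEK : η * (fbar (x K) - fbar xstar) ≤ h (x K) + η * f (x K) + (ωh (x K) + η * ωf (x K))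
        - (h xstar + η * f xstar + (ωh xstar + η * ωf xstar)) := by
      rw [← hstar_eq, hhbar, hhbar] at hDK_nonneg
      rw [hfbar, hfbar]
      linarith
    have hsq : 0 ≤ η * μf / 2 * ‖x 0 - xstar‖ ^ 2 := by positivity
    rw [hE₀] at h₁
    rcases le_total 0 (D₀ + η * u) with hE | hE
    · exact hEK.trans (h₁.trans (mul_le_mul_of_nonneg_right hqc hE))
    · have hcE := mul_le_mul_of_nonpos_right hc_le hE
      linarith
  have hpow : (K : ℝ) ^ (p + 1) = K ^ (p - 1) * K ^ 2 := by
    rw [← Real.rpow_natCast, ← Real.rpow_add hK_pos]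
    congr 1
    push_cast
    ring
  have hηc : c / η
      ≤ μf / ((Lh + ηbar * Lf) * (p + 1)) / ((K : ℝ) ^ (p - 1) * Real.log K) := by
    have heq : c / η = μf / ((Lh + ηbar * Lf) * (p + 1)) / ((K : ℝ) ^ (p - 1) * Real.log K)
        * ((p + 1) * Real.log K)⁻¹ := by
      rw [hc, hη, hpow]
      field_simp
    rw [heq]
    exact mul_le_of_le_one_right (by positivity) (inv_le_one_of_one_le₀ (by nlinarith))
  calc fbar (x K) - fbar xstar ≤ c * (D₀ + η * u) / η := by
        rw [le_div_iff₀ hη_pos]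
        linarith
    _ = u / (K : ℝ) ^ (p + 1) + c / η * D₀ := by
        rw [hc]
        field_simp
        ring
    _ ≤ u / (K : ℝ) ^ (p + 1) + μf / ((Lh + ηbar * Lf) * (p + 1))
          / ((K : ℝ) ^ (p - 1) * Real.log K) * D₀ := by gcongr
    _ = _ := by ring
end
end

section
/- Let (x_k) be the IR-ISTA iterates and θ_k := 1/∏_{t=0}^{k}(1 − η_t γ μ_f). Then for every integer K ≥ 1: Σ_{k=0}^{K−1} θ_k η_k (f̄(x_{k+1}) − f̄*) ≤ (1/(2γ))·( ‖x_0 − x*‖² − θ_{K−1}‖x_K − x*‖² ). -/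
open scoped RealInnerProductSpace
open Metric Filter

noncomputable section

section Helpers

variable {E : Type*} [NormedAddCommGroup E] [InnerProductSpace ℝ E]

lemma le_of_forall_one_sub_mul_le {a b : ℝ}
    (hab : ∀ t : ℝ, 0 < t → t < 1 → (1 - t) * a ≤ b) : a ≤ b := by
  have hlim : Tendsto (fun t : ℝ => (1 - t) * a) (nhdsWithin 0 (Set.Ioi 0)) (nhds a) := by
    have hc : Continuous fun t : ℝ => (1 - t) * a := by fun_prop
    simpa using (hc.tendsto 0).mono_left nhdsWithin_le_nhds
  refine le_of_tendsto hlim ?_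
  filter_upwards [Ioo_mem_nhdsGT (zero_lt_one (α := ℝ))] with t ht
  exact hab t ht.1 ht.2

lemma norm_sq_convex_combination (p q : E) (t : ℝ) :
    ‖(1 - t) • p + t • q‖ ^ 2
      = (1 - t) * ‖p‖ ^ 2 + t * ‖q‖ ^ 2 - t * (1 - t) * ‖q - p‖ ^ 2 := by
  rw [norm_add_sq_real, norm_sub_sq_real, norm_smul, norm_smul, mul_pow, mul_pow,
    Real.norm_eq_abs, Real.norm_eq_abs, sq_abs, sq_abs, real_inner_smul_left,
    real_inner_smul_right, real_inner_comm p q]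
  ring

/-- Three-point inequality for the proximal map of a convex function. -/
lemma ConvexOn.proximal_three_point {ψ : E → ℝ} (hψ : ConvexOn ℝ Set.univ ψ) {c : ℝ} {z p : E}
    (hp : ∀ u, ψ p + c * ‖p - z‖ ^ 2 ≤ ψ u + c * ‖u - z‖ ^ 2) (u : E) :
    ψ p + c * ‖p - z‖ ^ 2 + c * ‖u - p‖ ^ 2 ≤ ψ u + c * ‖u - z‖ ^ 2 := by
  suffices c * ‖u - p‖ ^ 2 ≤ ψ u + c * ‖u - z‖ ^ 2 - (ψ p + c * ‖p - z‖ ^ 2) by linarith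
  refine le_of_forall_one_sub_mul_le fun t ht0 ht1 => ?_
  have hconv := hψ.2 (Set.mem_univ p) (Set.mem_univ u) (sub_nonneg.2 ht1.le) ht0.le
    (sub_add_cancel 1 t)
  have hmin := hp ((1 - t) • p + t • u)
  have hz : (1 - t) • p + t • u - z = (1 - t) • (p - z) + t • (u - z) := by module
  rw [hz, norm_sq_convex_combination, sub_sub_sub_cancel_right] at hmin
  simp only [smul_eq_mul] at hconv
  refine le_of_mul_le_mul_left ?_ ht0
  linear_combination hmin + hconv

lemma HasGradientAt.hasDerivAt_comp_add_smul [CompleteSpace E] {f : E → ℝ} {g x v : E} {t : ℝ}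
    (hf : HasGradientAt f g (x + t • v)) :
    HasDerivAt (fun s : ℝ => f (x + s • v)) ⟪g, v⟫ t := by
  have hline : HasDerivAt (fun s : ℝ => x + s • v) v t := by
    simpa using ((hasDerivAt_id t).smul_const v).const_add x
  simpa [Function.comp_def] using hf.hasFDerivAt.comp_hasDerivAt t hline

/-- First-order lower bound for a strongly convex function. -/
lemma StrongConvexOn.gradient_lower_bound [CompleteSpace E] {f : E → ℝ} {m : ℝ} {g x : E}
    (hf : StrongConvexOn Set.univ m f) (hg : HasGradientAt f g x) (u : E) :
    f x + ⟪g, u - x⟫ + m / 2 * ‖u - x‖ ^ 2 ≤ f u := by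
  have hd : HasDerivAt (fun s : ℝ => f (x + s • (u - x))) ⟪g, u - x⟫ 0 :=
    HasGradientAt.hasDerivAt_comp_add_smul (by simpa using hg)
  have hlim : Tendsto (fun t : ℝ => f u - f x - (1 - t) * (m / 2 * ‖u - x‖ ^ 2))
      (nhdsWithin 0 (Set.Ioi 0)) (nhds (f u - f x - m / 2 * ‖u - x‖ ^ 2)) := by
    have hc : Continuous fun t : ℝ => f u - f x - (1 - t) * (m / 2 * ‖u - x‖ ^ 2) := by fun_prop
    simpa using (hc.tendsto 0).mono_left nhdsWithin_le_nhds
  suffices ⟪g, u - x⟫ ≤ f u - f x - m / 2 * ‖u - x‖ ^ 2 by linarith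
  refine le_of_tendsto_of_tendsto hd.tendsto_slope_zero_right hlim ?_
  filter_upwards [Ioo_mem_nhdsGT (zero_lt_one (α := ℝ))] with t ht
  have hconv := hf.2 (Set.mem_univ x) (Set.mem_univ u) (sub_nonneg.2 ht.2.le) ht.1.le
    (sub_add_cancel 1 t)
  have hpt : (1 - t) • x + t • u = x + t • (u - x) := by module
  rw [hpt, norm_sub_rev] at hconv
  simp only [smul_eq_mul] at hconv
  simp only [zero_add, zero_smul, add_zero, smul_eq_mul]
  rw [inv_mul_le_iff₀ ht.1]
  linear_combination hconv

/-- Descent lemma: quadratic upper bound for a function with Lipschitz gradient. -/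
lemma le_quadratic_of_gradient_lipschitz [CompleteSpace E] {f : E → ℝ} {f' : E → E} {L : ℝ}
    (hg : ∀ x, HasGradientAt f (f' x) x) (hL : ∀ x y, ‖f' x - f' y‖ ≤ L * ‖x - y‖) (x u : E) :
    f u ≤ f x + ⟪f' x, u - x⟫ + L / 2 * ‖u - x‖ ^ 2 := by
  set v := u - x with hv
  have hd : ∀ t : ℝ, HasDerivAt
      (fun s : ℝ => f (x + s • v) - s * ⟪f' x, v⟫ - L / 2 * ‖v‖ ^ 2 * s ^ 2)
      (⟪f' (x + t • v) - f' x, v⟫ - L * ‖v‖ ^ 2 * t) t := fun t => by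
    have h1 := (hg (x + t • v)).hasDerivAt_comp_add_smul
    have h2 := (hasDerivAt_id t).mul_const ⟪f' x, v⟫
    have h3 := (hasDerivAt_pow 2 t).const_mul (L / 2 * ‖v‖ ^ 2)
    refine ((h1.sub h2).sub h3).congr_deriv ?_
    rw [inner_sub_left]
    norm_num
    ring
  have hanti := antitoneOn_of_hasDerivWithinAt_nonpos (convex_Ici (0 : ℝ))
    (fun t _ => (hd t).continuousAt.continuousWithinAt) (fun t _ => (hd t).hasDerivWithinAt)
    (fun t ht => by
      rw [interior_Ici] at ht
      have hlip := hL (x + t • v) x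
      rw [add_sub_cancel_left, norm_smul, Real.norm_of_nonneg (le_of_lt ht)] at hlip
      have hcs := real_inner_le_norm (f' (x + t • v) - f' x) v
      have hmul := mul_le_mul_of_nonneg_right hlip (norm_nonneg v)
      linear_combination hcs + hmul)
  have h01 := hanti (Set.mem_Ici.2 le_rfl) (Set.mem_Ici.2 zero_le_one) zero_le_one
  have hu : x + (1 : ℝ) • v = u := by rw [hv]; module
  simp only [hu, zero_smul, add_zero] at h01
  linear_combination h01

/-- One step of proximal gradient on `h + ωh + η (f + ωf)`, compared with any point `u`. -/
lemma proximal_gradient_step [CompleteSpace E] {f h ωf ωh : E → ℝ} {f' h' : E → E}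
    {Lf Lh μ η γ : ℝ} {x p : E}
    (hf_grad : ∀ x, HasGradientAt f (f' x) x)
    (hf_lip : ∀ x y, ‖f' x - f' y‖ ≤ Lf * ‖x - y‖)
    (hf_sc : StrongConvexOn Set.univ μ f)
    (hh_grad : ∀ x, HasGradientAt h (h' x) x)
    (hh_lip : ∀ x y, ‖h' x - h' y‖ ≤ Lh * ‖x - y‖)
    (hh_conv : ConvexOn ℝ Set.univ h)
    (hωf_conv : ConvexOn ℝ Set.univ ωf) (hωh_conv : ConvexOn ℝ Set.univ ωh)
    (hη : 0 ≤ η) (hγ : 0 < γ) (hγL : γ * (Lh + η * Lf) ≤ 1)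
    (hp : ∀ u, ωh p + η * ωf p + 1 / (2 * γ) * ‖p - (x - γ • (h' x + η • f' x))‖ ^ 2
      ≤ ωh u + η * ωf u + 1 / (2 * γ) * ‖u - (x - γ • (h' x + η • f' x))‖ ^ 2) (u : E) :
    h p + ωh p + η * (f p + ωf p) + 1 / (2 * γ) * ‖u - p‖ ^ 2
      ≤ h u + ωh u + η * (f u + ωf u) + 1 / (2 * γ) * ((1 - η * γ * μ) * ‖u - x‖ ^ 2) := by
  have hψ : ConvexOn ℝ Set.univ fun u => ωh u + η * ωf u := hωh_conv.add (hωf_conv.smul hη)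
  have hprox := hψ.proximal_three_point hp u
  have hexpand : ∀ w : E, 1 / (2 * γ) * ‖w - (x - γ • (h' x + η • f' x))‖ ^ 2
      = 1 / (2 * γ) * ‖w - x‖ ^ 2 + (⟪h' x, w - x⟫ + η * ⟪f' x, w - x⟫)
        + γ / 2 * ‖h' x + η • f' x‖ ^ 2 := fun w => by
    have hw : w - (x - γ • (h' x + η • f' x)) = (w - x) + γ • (h' x + η • f' x) := by abel
    rw [hw, norm_add_sq_real, norm_smul, mul_pow, Real.norm_eq_abs, sq_abs,
      real_inner_smul_right, inner_add_right, real_inner_smul_right,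
      real_inner_comm (w - x) (h' x), real_inner_comm (w - x) (f' x)]
    field_simp
  simp only [hexpand] at hprox
  have hhp := le_quadratic_of_gradient_lipschitz hh_grad hh_lip x p
  have hfp := mul_le_mul_of_nonneg_left
    (le_quadratic_of_gradient_lipschitz hf_grad hf_lip x p) hη
  have hhu := (strongConvexOn_zero.2 hh_conv).gradient_lower_bound (hh_grad x) u
  have hfu := mul_le_mul_of_nonneg_left (hf_sc.gradient_lower_bound (hf_grad x) u) hη
  have hL : (Lh + η * Lf) / 2 ≤ 1 / (2 * γ) := by
    rw [div_le_div_iff₀ two_pos (by positivity)]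
    linarith
  have hstep := mul_le_mul_of_nonneg_right hL (sq_nonneg ‖p - x‖)
  have hγμ : 1 / (2 * γ) * ((1 - η * γ * μ) * ‖u - x‖ ^ 2)
      = 1 / (2 * γ) * ‖u - x‖ ^ 2 - η * (μ / 2 * ‖u - x‖ ^ 2) := by
    field_simp
  rw [hγμ]
  linear_combination hprox + hhp + hfp + hhu + hfu + hstep

/-- Weighted telescoping of a recursion `b k ≤ c (q k * a k - a (k + 1))` with weights
`1 / ∏ q`. -/
lemma sum_weighted_le_of_contraction {a b q θ : ℕ → ℝ} {c : ℝ} (hq : ∀ k, 0 < q k)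
    (hθ : ∀ k, θ k = 1 / ∏ t ∈ Finset.range (k + 1), q t)
    (hstep : ∀ k, b k ≤ c * (q k * a k - a (k + 1))) (K : ℕ) :
    ∑ k ∈ Finset.range (K + 1), θ k * b k ≤ c * (a 0 - θ K * a (K + 1)) := by
  have hθ_pos : ∀ k, 0 < θ k := fun k => by
    rw [hθ]
    exact one_div_pos.2 (Finset.prod_pos fun t _ => hq t)
  induction K with
  | zero =>
    have h0 : θ 0 * q 0 = 1 := by
      rw [hθ, Finset.prod_range_one, one_div, inv_mul_cancel₀ (hq 0).ne']
    have hm := mul_le_mul_of_nonneg_left (hstep 0) (hθ_pos 0).le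
    rw [Finset.sum_range_one]
    linear_combination hm + c * a 0 * h0
  | succ K ih =>
    have hs : θ (K + 1) * q (K + 1) = θ K := by
      have hprod : ∏ t ∈ Finset.range (K + 1), q t ≠ 0 :=
        (Finset.prod_pos fun t _ => hq t).ne'
      have hqK := (hq (K + 1)).ne'
      rw [hθ, hθ, Finset.prod_range_succ _ (K + 1)]
      field_simp
    have hm := mul_le_mul_of_nonneg_left (hstep (K + 1)) (hθ_pos (K + 1)).le
    rw [Finset.sum_range_succ]
    linear_combination ih + hm + c * a (K + 1) * hs

end Helpers

theorem stmt_7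
    {n : ℕ}
    (f h ωf ωh : EuclideanSpace ℝ (Fin n) → ℝ)
    (f' h' : EuclideanSpace ℝ (Fin n) → EuclideanSpace ℝ (Fin n))
    (Lf Lh μf : ℝ)
    (hμf_pos : 0 < μf) (hμf_le : μf ≤ Lf) (hLh_pos : 0 < Lh)
    (hf_grad : ∀ x, HasGradientAt f (f' x) x)
    (hf_lip : ∀ x y, ‖f' x - f' y‖ ≤ Lf * ‖x - y‖)
    (hf_sc : StrongConvexOn Set.univ μf f)
    (hh_grad : ∀ x, HasGradientAt h (h' x) x)
    (hh_lip : ∀ x y, ‖h' x - h' y‖ ≤ Lh * ‖x - y‖)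
    (hh_conv : ConvexOn ℝ Set.univ h)
    (hωf_conv : ConvexOn ℝ Set.univ ωf)
    (hωh_conv : ConvexOn ℝ Set.univ ωh)
    (fbar hbar : EuclideanSpace ℝ (Fin n) → ℝ)
    (hfbar : ∀ x, fbar x = f x + ωf x)
    (hhbar : ∀ x, hbar x = h x + ωh x)
    (X : Set (EuclideanSpace ℝ (Fin n)))
    (hX : X = {z | ∀ y, hbar z ≤ hbar y})
    (hXne : X.Nonempty)
    (hstar : ℝ)
    (hhstar : IsGLB (Set.range hbar) hstar)
    (xstar : EuclideanSpace ℝ (Fin n))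
    (hxstar_mem : xstar ∈ X)
    (hxstar_min : ∀ y ∈ X, fbar xstar ≤ fbar y)
    (x : ℕ → EuclideanSpace ℝ (Fin n))
    (η : ℕ → ℝ) (γ : ℝ)
    (hη_pos : ∀ k, 0 < η k)
    (hη_mono : ∀ k, η (k+1) ≤ η k)
    (hγ_pos : 0 < γ)
    (hγ_le : γ ≤ 1 / (Lh + η 0 * Lf))
    (hx_iter : ∀ k u,
      ωh (x (k+1)) + η k * ωf (x (k+1))
        + 1 / (2*γ) * ‖x (k+1) - (x k - γ • (h' (x k) + η k • f' (x k)))‖ ^ 2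
      ≤ ωh u + η k * ωf u
        + 1 / (2*γ) * ‖u - (x k - γ • (h' (x k) + η k • f' (x k)))‖ ^ 2)
    (θ : ℕ → ℝ)
    (hθ : ∀ k, θ k = 1 / ∏ t ∈ Finset.range (k+1), (1 - η t * γ * μf))
    :
    ∀ K : ℕ, 1 ≤ K →
      ∑ k ∈ Finset.range K, θ k * η k * (fbar (x (k+1)) - fbar xstar)
        ≤ 1 / (2*γ) * (‖x 0 - xstar‖ ^ 2 - θ (K-1) * ‖x K - xstar‖ ^ 2) := by
  have hLf_pos : 0 < Lf := hμf_pos.trans_le hμf_le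
  have hη_anti : Antitone η := antitone_nat_of_succ_le hη_mono
  have hη0Lf : 0 < η 0 * Lf := mul_pos (hη_pos 0) hLf_pos
  have hγL0 : γ * (Lh + η 0 * Lf) ≤ 1 := (le_div_iff₀ (by positivity)).1 hγ_le
  have hη_le : ∀ k, η k * Lf ≤ η 0 * Lf := fun k =>
    mul_le_mul_of_nonneg_right (hη_anti (Nat.zero_le k)) hLf_pos.le
  have hγL : ∀ k, γ * (Lh + η k * Lf) ≤ 1 := fun k =>
    (mul_le_mul_of_nonneg_left (add_le_add_right (hη_le k) Lh) hγ_pos.le).trans hγL0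
  have hq : ∀ k, 0 < 1 - η k * γ * μf := fun k => by
    have h1 := mul_le_mul_of_nonneg_left hμf_le (mul_pos (hη_pos k) hγ_pos).le
    have h2 := mul_pos hγ_pos hLh_pos
    linarith [hγL k]
  have hstep : ∀ k, η k * (fbar (x (k + 1)) - fbar xstar)
      ≤ 1 / (2 * γ) * ((1 - η k * γ * μf) * ‖x k - xstar‖ ^ 2 - ‖x (k + 1) - xstar‖ ^ 2) :=
    fun k => by
    have hmain := proximal_gradient_step hf_grad hf_lip hf_sc hh_grad hh_lip hh_conv hωf_conv
      hωh_conv (hη_pos k).le hγ_pos (hγL k) (hx_iter k) xstar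
    have hopt : hbar xstar ≤ hbar (x (k + 1)) := by
      rw [hX] at hxstar_mem
      exact hxstar_mem _
    rw [← hfbar, ← hfbar, ← hhbar, ← hhbar, norm_sub_rev xstar, norm_sub_rev xstar] at hmain
    linear_combination hmain + hopt
  intro K hK
  obtain ⟨K, rfl⟩ := Nat.exists_eq_add_of_le' hK
  simpa only [mul_assoc, Nat.add_sub_cancel] using
    sum_weighted_le_of_contraction (a := fun k => ‖x k - xstar‖ ^ 2) hq hθ hstep K
end
end

section
/- Let (x_k) be the IR-ISTA iterates with weights θ_k := 1/∏_{t=0}^{k}(1 − η_t γ μ_f) and averaged iterates x̄_K := (Σ_{k=0}^{K−1} θ_k η_k x_{k+1})/(Σ_{k=0}^{K−1} θ_k η_k). If in addition Ĉ_f̄ := inf_{x∈E} f̄(x) > −∞ and sup_{K≥1} (Σ_{j=0}^{K−1} θ_j η_j)/θ_{K−1} < ∞, then the averaged iterates are bounded: there exists u > 0 such that ‖x̄_K‖ ≤ u for all K ≥ 1. -/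
open scoped RealInnerProductSpace
open Metric Filter

noncomputable section

section Helpers

variable {E : Type*} [NormedAddCommGroup E] [InnerProductSpace ℝ E]

/-- A lower bound that is linear in a parameter `t ∈ (0, 1]` passes to the limit `t → 0`. -/
lemma nonneg_of_forall_add_mul_nonneg {a b : ℝ}
    (hab : ∀ t : ℝ, 0 < t → t ≤ 1 → 0 ≤ a + t * b) : 0 ≤ a := by
  by_contra! ha
  have hb : 0 < |b| + 1 := by positivity
  set t := min 1 (-a / (2 * (|b| + 1))) with ht
  have ht0 : 0 < t := lt_min one_pos (div_pos (by linarith) (by positivity))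
  have hle : t * (2 * (|b| + 1)) ≤ -a :=
    (le_div_iff₀ (by positivity)).1 (min_le_right _ _)
  have := hab t ht0 (min_le_left _ _)
  nlinarith [mul_le_mul_of_nonneg_left (le_abs_self b) ht0.le]

/-- The derivative of a function along a line, in terms of its gradient. -/
lemma HasGradientAt.hasDerivAt_line [CompleteSpace E] {f : E → ℝ} {g x d : E} {t : ℝ}
    (hf : HasGradientAt f g (x + t • d)) :
    HasDerivAt (fun s : ℝ => f (x + s • d)) ⟪g, d⟫ t := by
  have hline : HasDerivAt (fun s : ℝ => x + s • d) d t := by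
    simpa using ((hasDerivAt_id t).smul_const d).const_add x
  simpa [Function.comp_def] using hf.hasFDerivAt.comp_hasDerivAt t hline

/-- First-order lower bound for strongly convex functions. -/
lemma StrongConvexOn.add_inner_le [CompleteSpace E] {f : E → ℝ} {m : ℝ} {g x : E}
    (hf : StrongConvexOn Set.univ m f) (hg : HasGradientAt f g x) (y : E) :
    f x + ⟪g, y - x⟫ + m / 2 * ‖y - x‖ ^ 2 ≤ f y := by
  have hder : HasDerivAt (fun s : ℝ => f (x + s • (y - x))) ⟪g, y - x⟫ 0 :=
    HasGradientAt.hasDerivAt_line (by simpa using hg)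
  have hlim := (hasDerivAt_iff_tendsto_slope.1 hder).mono_left
    (nhdsWithin_mono 0 (fun t (ht : t ∈ Set.Ioi (0 : ℝ)) => ne_of_gt ht))
  have hrhs : Tendsto (fun t : ℝ => f y - f x - (1 - t) * (m / 2 * ‖y - x‖ ^ 2))
      (nhdsWithin 0 (Set.Ioi 0)) (nhds (f y - f x - (1 - 0) * (m / 2 * ‖y - x‖ ^ 2))) :=
    (Continuous.tendsto (by fun_prop) 0).mono_left nhdsWithin_le_nhds
  have hle := le_of_tendsto_of_tendsto hlim hrhs (by
    filter_upwards [Ioo_mem_nhdsGT (zero_lt_one (α := ℝ))] with t ht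
    have h := hf.2 (Set.mem_univ x) (Set.mem_univ y) (sub_nonneg.2 ht.2.le) ht.1.le
      (sub_add_cancel 1 t)
    have hpt : (1 - t) • x + t • y = x + t • (y - x) := by module
    rw [hpt, norm_sub_rev x y] at h
    simp only [smul_eq_mul] at h
    simp only [slope_def_field, zero_smul, add_zero, sub_zero]
    rw [div_le_iff₀ ht.1]
    linarith)
  linarith

/-- Quadratic upper bound for functions with Lipschitz gradient. -/
lemma le_add_inner_add_of_gradient_lipschitz [CompleteSpace E] {f : E → ℝ} {f' : E → E} {L : ℝ}
    (hg : ∀ x, HasGradientAt f (f' x) x) (hlip : ∀ x y, ‖f' x - f' y‖ ≤ L * ‖x - y‖) (x y : E) :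
    f y ≤ f x + ⟪f' x, y - x⟫ + L / 2 * ‖y - x‖ ^ 2 := by
  set d := y - x with hd
  have hder : ∀ t : ℝ, HasDerivAt
      (fun s : ℝ => f (x + s • d) - s * ⟪f' x, d⟫ - s ^ 2 * (L / 2 * ‖d‖ ^ 2))
      (⟪f' (x + t • d), d⟫ - ⟪f' x, d⟫ - 2 * t * (L / 2 * ‖d‖ ^ 2)) t := fun t => by
    have h1 := (hg (x + t • d)).hasDerivAt_line
    have h2 := (hasDerivAt_id t).mul_const ⟪f' x, d⟫
    have h3 := (hasDerivAt_pow 2 t).mul_const (L / 2 * ‖d‖ ^ 2)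
    simpa using (h1.fun_sub h2).fun_sub h3
  have hanti := antitoneOn_of_deriv_nonpos (convex_Icc (0 : ℝ) 1)
    (fun t _ => (hder t).continuousAt.continuousWithinAt)
    (fun t _ => (hder t).differentiableAt.differentiableWithinAt)
    (fun t ht => by
      rw [interior_Icc] at ht
      rw [(hder t).deriv, ← inner_sub_left]
      have h1 := real_inner_le_norm (f' (x + t • d) - f' x) d
      have h2 := hlip (x + t • d) x
      rw [add_sub_cancel_left, norm_smul, Real.norm_of_nonneg ht.1.le] at h2
      nlinarith [mul_le_mul_of_nonneg_right h2 (norm_nonneg d)])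
  have h := hanti (Set.left_mem_Icc.2 zero_le_one) (Set.right_mem_Icc.2 zero_le_one) zero_le_one
  simp only [one_smul, zero_smul, add_zero] at h
  rw [hd, add_sub_cancel] at h
  linarith

/-- The three-point inequality for a proximal step `p` of a convex function at `v`. -/
lemma ConvexOn.prox_three_point {φ : E → ℝ} (hφ : ConvexOn ℝ Set.univ φ) {c : ℝ} {p v : E}
    (hp : ∀ u, φ p + c * ‖p - v‖ ^ 2 ≤ φ u + c * ‖u - v‖ ^ 2) (u : E) :
    φ p + c * ‖p - v‖ ^ 2 + c * ‖u - p‖ ^ 2 ≤ φ u + c * ‖u - v‖ ^ 2 := by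
  have key : 0 ≤ φ u - φ p + 2 * c * ⟪p - v, u - p⟫ := by
    refine nonneg_of_forall_add_mul_nonneg (b := c * ‖u - p‖ ^ 2) fun t ht0 ht1 => ?_
    have h1 := hp (p + t • (u - p))
    have h2 := hφ.2 (Set.mem_univ p) (Set.mem_univ u) (sub_nonneg.2 ht1) ht0.le
      (sub_add_cancel 1 t)
    have hpt : (1 - t) • p + t • u = p + t • (u - p) := by module
    have hsq : ‖p + t • (u - p) - v‖ ^ 2
        = ‖p - v‖ ^ 2 + 2 * (t * ⟪p - v, u - p⟫) + t ^ 2 * ‖u - p‖ ^ 2 := by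
      rw [add_sub_right_comm, norm_add_sq_real, real_inner_smul_right, norm_smul, mul_pow,
        Real.norm_eq_abs, sq_abs]
    rw [hpt] at h2
    simp only [smul_eq_mul] at h2
    rw [hsq] at h1
    refine nonneg_of_mul_nonneg_right (a := t) ?_ ht0
    linarith
  have hsq : ‖u - v‖ ^ 2 = ‖p - v‖ ^ 2 + 2 * ⟪p - v, u - p⟫ + ‖u - p‖ ^ 2 := by
    rw [← norm_add_sq_real]
    congr 2
    abel
  rw [hsq]
  linarith

/-- One proximal gradient step `p` from `x` for the composite objective `g + φ`, where `g` is
bounded below at `u` and above at `p` by its quadratic models at `x`. -/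
lemma ConvexOn.prox_gradient_step {φ g : E → ℝ} (hφ : ConvexOn ℝ Set.univ φ) {γ m : ℝ}
    (hγ : 0 < γ) {x p u G : E}
    (hp : ∀ w, φ p + 1 / (2 * γ) * ‖p - (x - γ • G)‖ ^ 2
      ≤ φ w + 1 / (2 * γ) * ‖w - (x - γ • G)‖ ^ 2)
    (hlow : g x + ⟪G, u - x⟫ + m / 2 * ‖u - x‖ ^ 2 ≤ g u)
    (hup : g p ≤ g x + ⟪G, p - x⟫ + 1 / (2 * γ) * ‖p - x‖ ^ 2) :
    2 * γ * (g p + φ p) + ‖p - u‖ ^ 2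
      ≤ 2 * γ * (g u + φ u) + (1 - γ * m) * ‖x - u‖ ^ 2 := by
  have hexp : ∀ w, 1 / (2 * γ) * ‖w - (x - γ • G)‖ ^ 2
      = 1 / (2 * γ) * ‖w - x‖ ^ 2 + ⟪G, w - x⟫ + γ / 2 * ‖G‖ ^ 2 := fun w => by
    rw [← sub_add, norm_add_sq_real, real_inner_smul_right, norm_smul, mul_pow,
      Real.norm_eq_abs, sq_abs, real_inner_comm]
    field_simp
  have h := hφ.prox_three_point hp u
  rw [hexp, hexp] at h
  rw [norm_sub_rev p u, norm_sub_rev x u]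
  have h' : g p + φ p + 1 / (2 * γ) * ‖u - p‖ ^ 2
      ≤ g u + φ u + 1 / (2 * γ) * ‖u - x‖ ^ 2 - m / 2 * ‖u - x‖ ^ 2 := by linarith
  have h2 := mul_le_mul_of_nonneg_left h' (by positivity : 0 ≤ 2 * γ)
  have e : ∀ a : ℝ, 2 * γ * (1 / (2 * γ) * a) = a := fun a => by field_simp
  have e1 := e (‖u - p‖ ^ 2)
  have e2 := e (‖u - x‖ ^ 2)
  linarith

end Helpers

theorem stmt_8
    {n : ℕ}
    (f h ωf ωh : EuclideanSpace ℝ (Fin n) → ℝ)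
    (f' h' : EuclideanSpace ℝ (Fin n) → EuclideanSpace ℝ (Fin n))
    (Lf Lh μf : ℝ)
    (hμf_pos : 0 < μf) (hμf_le : μf ≤ Lf) (hLh_pos : 0 < Lh)
    (hf_grad : ∀ x, HasGradientAt f (f' x) x)
    (hf_lip : ∀ x y, ‖f' x - f' y‖ ≤ Lf * ‖x - y‖)
    (hf_sc : StrongConvexOn Set.univ μf f)
    (hh_grad : ∀ x, HasGradientAt h (h' x) x)
    (hh_lip : ∀ x y, ‖h' x - h' y‖ ≤ Lh * ‖x - y‖)
    (hh_conv : ConvexOn ℝ Set.univ h)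
    (hωf_conv : ConvexOn ℝ Set.univ ωf)
    (hωh_conv : ConvexOn ℝ Set.univ ωh)
    (fbar hbar : EuclideanSpace ℝ (Fin n) → ℝ)
    (hfbar : ∀ x, fbar x = f x + ωf x)
    (hhbar : ∀ x, hbar x = h x + ωh x)
    (X : Set (EuclideanSpace ℝ (Fin n)))
    (hX : X = {z | ∀ y, hbar z ≤ hbar y})
    (hXne : X.Nonempty)
    (hstar : ℝ)
    (hhstar : IsGLB (Set.range hbar) hstar)
    (xstar : EuclideanSpace ℝ (Fin n))
    (hxstar_mem : xstar ∈ X)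
    (hxstar_min : ∀ y ∈ X, fbar xstar ≤ fbar y)
    (x : ℕ → EuclideanSpace ℝ (Fin n))
    (η : ℕ → ℝ) (γ : ℝ)
    (hη_pos : ∀ k, 0 < η k)
    (hη_mono : ∀ k, η (k+1) ≤ η k)
    (hγ_pos : 0 < γ)
    (hγ_le : γ ≤ 1 / (Lh + η 0 * Lf))
    (hx_iter : ∀ k u,
      ωh (x (k+1)) + η k * ωf (x (k+1))
        + 1 / (2*γ) * ‖x (k+1) - (x k - γ • (h' (x k) + η k • f' (x k)))‖ ^ 2
      ≤ ωh u + η k * ωf u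
        + 1 / (2*γ) * ‖u - (x k - γ • (h' (x k) + η k • f' (x k)))‖ ^ 2)
    (θ : ℕ → ℝ)
    (hθ : ∀ k, θ k = 1 / ∏ t ∈ Finset.range (k+1), (1 - η t * γ * μf))
    (xbar : ℕ → EuclideanSpace ℝ (Fin n))
    (hxbar : ∀ K, xbar K = (∑ j ∈ Finset.range K, θ j * η j)⁻¹ •
        ∑ k ∈ Finset.range K, (θ k * η k) • x (k+1))
    (Cf : ℝ)
    (hCf : IsGLB (Set.range fbar) Cf)
    (hsup : ∃ M : ℝ, ∀ K : ℕ, 1 ≤ K →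
        (∑ j ∈ Finset.range K, θ j * η j) / θ (K - 1) ≤ M) :
    ∃ u : ℝ, 0 < u ∧ ∀ K : ℕ, 1 ≤ K → ‖xbar K‖ ≤ u := by
  have hLf_pos : 0 < Lf := hμf_pos.trans_le hμf_le
  have hη_le : ∀ k, η k ≤ η 0 := fun k => antitone_nat_of_succ_le hη_mono (Nat.zero_le k)
  have hγη : ∀ k, γ * (Lh + η k * Lf) ≤ 1 := fun k => by
    have h0 : 0 < Lh + η 0 * Lf := by have := mul_pos (hη_pos 0) hLf_pos; linarith
    calc γ * (Lh + η k * Lf) ≤ γ * (Lh + η 0 * Lf) := by gcongr; exact hη_le k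
      _ ≤ 1 := (le_div_iff₀ h0).1 hγ_le
  have hq : ∀ k, 0 < 1 - η k * γ * μf := fun k => by
    nlinarith [hγη k, mul_pos hγ_pos hLh_pos,
      mul_le_mul_of_nonneg_left hμf_le (mul_pos (hη_pos k) hγ_pos).le]
  have hθ_pos : ∀ k, 0 < θ k := fun k => by
    rw [hθ]
    exact one_div_pos.2 (Finset.prod_pos fun t _ => hq t)
  have hstep : ∀ k, ‖x (k + 1) - xstar‖ ^ 2
      ≤ (1 - η k * γ * μf) * ‖x k - xstar‖ ^ 2 + 2 * γ * η k * (fbar xstar - Cf) := fun k => by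
    have hφ : ConvexOn ℝ Set.univ (fun u => ωh u + η k * ωf u) :=
      hωh_conv.add (hωf_conv.smul (hη_pos k).le)
    have hpg := hφ.prox_gradient_step (g := fun u => h u + η k * f u) (m := η k * μf)
      (u := xstar) hγ_pos (hx_iter k)
      (by
        have h1 := (strongConvexOn_zero.2 hh_conv).add_inner_le (hh_grad (x k)) xstar
        have h2 := mul_le_mul_of_nonneg_left (hf_sc.add_inner_le (hf_grad (x k)) xstar)
          (hη_pos k).le
        rw [inner_add_left, real_inner_smul_left]
        linarith)
      (by
        have h1 := le_add_inner_add_of_gradient_lipschitz hh_grad hh_lip (x k) (x (k + 1))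
        have h2 := mul_le_mul_of_nonneg_left
          (le_add_inner_add_of_gradient_lipschitz hf_grad hf_lip (x k) (x (k + 1))) (hη_pos k).le
        have h3 : (Lh + η k * Lf) / 2 ≤ 1 / (2 * γ) := by
          rw [div_le_div_iff₀ two_pos (by positivity)]
          linarith [hγη k]
        have h4 := mul_le_mul_of_nonneg_right h3 (sq_nonneg ‖x (k + 1) - x k‖)
        rw [inner_add_left, real_inner_smul_left]
        linarith)
    have hmin : hbar xstar ≤ hbar (x (k + 1)) := by
      rw [hX] at hxstar_mem
      exact hxstar_mem _
    have hC : Cf ≤ fbar (x (k + 1)) := hCf.1 ⟨_, rfl⟩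
    have h1 := mul_le_mul_of_nonneg_left hmin hγ_pos.le
    have h2 := mul_le_mul_of_nonneg_left hC (mul_pos hγ_pos (hη_pos k)).le
    rw [hhbar, hhbar] at h1
    rw [hfbar] at h2 ⊢
    linarith
  set B := max (‖x 0 - xstar‖ ^ 2) (2 * (fbar xstar - Cf) / μf) with hB
  have hbound : ∀ k, ‖x k - xstar‖ ^ 2 ≤ B := fun k => by
    induction k with
    | zero => exact le_max_left _ _
    | succ k ih =>
      have hD : 2 * (fbar xstar - Cf) ≤ B * μf := (div_le_iff₀ hμf_pos).1 (le_max_right _ _)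
      have h1 := mul_le_mul_of_nonneg_left ih (hq k).le
      have h2 := mul_le_mul_of_nonneg_left hD (mul_pos hγ_pos (hη_pos k)).le
      linarith [hstep k]
  have hxk : ∀ k, ‖x k‖ ≤ √B + ‖xstar‖ := fun k => by
    have h1 := Real.le_sqrt_of_sq_le (hbound k)
    have h2 := norm_add_le (x k - xstar) xstar
    rw [sub_add_cancel] at h2
    linarith
  refine ⟨√B + ‖xstar‖ + 1, by positivity, fun K hK => ?_⟩
  have hw : ∀ k, 0 < θ k * η k := fun k => mul_pos (hθ_pos k) (hη_pos k)
  have hS : 0 < ∑ j ∈ Finset.range K, θ j * η j :=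
    Finset.sum_pos (fun k _ => hw k) (Finset.nonempty_range_iff.2 (by omega))
  have hsum : ‖∑ k ∈ Finset.range K, (θ k * η k) • x (k + 1)‖
      ≤ (∑ j ∈ Finset.range K, θ j * η j) * (√B + ‖xstar‖) := by
    rw [Finset.sum_mul]
    refine norm_sum_le_of_le _ fun k _ => ?_
    rw [norm_smul, Real.norm_of_nonneg (hw k).le]
    exact mul_le_mul_of_nonneg_left (hxk _) (hw k).le
  rw [hxbar, norm_smul, norm_inv, Real.norm_of_nonneg hS.le, inv_mul_le_iff₀ hS]
  linarith
end
end
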